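/- arXiv:1812.06063 — 2 statements merged into one kernel-verified Lean document; each statement's English description precedes it below -/
import Mathlib

section
/- Let k be a power of 2 and f a non-increasing probability density on {1,…,k}. If n ≥ 64 and 2 n^{1/3} ≤ k < n^{1/3} 2^n, then the number of leaves of the idealized tree satisfies |L*| ≤ 12 n^{1/3} (log₂(k/n^{1/3}))^{2/3}. -/
open Finset

/-- For `k = 2^m`, the node at depth `j` and position `i` (for `i < 2^j`) of the
complete binary tree of dyadic subintervals of `{1, …, 2^m}` covers the interval
`I_{j,i} = {i · 2^{m-j} + 1, …, (i+1) · 2^{m-j}}`. -/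
def nodeInterval (m j i : ℕ) : Finset ℕ :=
  Finset.Icc (i * 2 ^ (m - j) + 1) ((i + 1) * 2 ^ (m - j))

/-- `f_{I_{j,i}} = ∑_{x ∈ I_{j,i}} f x`, the mass of `f` on the interval of node `(j, i)`. -/
noncomputable def blockSum (f : ℕ → ℝ) (m j i : ℕ) : ℝ :=
  ∑ x ∈ nodeInterval m j i, f x

/-- The idealized splitting rule: the node `(j, i)` splits iff its interval has more
than one point (i.e. `j < m`) and, with `I_v`, `I_w` the left and right halves of its
interval, `f_{I_v} - f_{I_w} > √((f_{I_v} + f_{I_w})/n)`. -/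
def Splits (f : ℕ → ℝ) (n m j i : ℕ) : Prop :=
  j < m ∧
    blockSum f m (j + 1) (2 * i) - blockSum f m (j + 1) (2 * i + 1) >
      Real.sqrt ((blockSum f m (j + 1) (2 * i) + blockSum f m (j + 1) (2 * i + 1)) / n)

/-- Membership of the node `(j, i)` in the idealized tree `T*(f)`: the root `(0, 0)`
is in the tree, and a node is in the tree iff its parent is in the tree and splits. -/
def InTree (f : ℕ → ℝ) (n m : ℕ) : ℕ → ℕ → Prop
  | 0, i => i = 0
  | j + 1, i => InTree f n m j (i / 2) ∧ Splits f n m j (i / 2)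

/-- The node `(j, i)` is a leaf of the idealized tree `T*(f)`: it belongs to the tree
and does not split. -/
def IsLeaf (f : ℕ → ℝ) (n m j i : ℕ) : Prop :=
  InTree f n m j i ∧ ¬ Splits f n m j i


open Classical in
/-- Number of leaves of the subtree of height `h` below `(j, i)`. -/
noncomputable def leafCount (f : ℕ → ℝ) (n m : ℕ) : ℕ → ℕ → ℕ → ℕ
  | 0, _, _ => 1
  | h + 1, j, i =>
    if Splits f n m j i then
      leafCount f n m h (j + 1) (2 * i) + leafCount f n m h (j + 1) (2 * i + 1)
    else 1

open Classical in
/-- Number of splitting positions at depth `j` in `[p, p + l)`. -/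
noncomputable def splitCount (f : ℕ → ℝ) (n m j p l : ℕ) : ℕ :=
  ((Finset.range l).filter (fun r => Splits f n m j (p + r))).card

lemma inTree_anc (f : ℕ → ℝ) (n m : ℕ) (j : ℕ) (d : ℕ) :
    ∀ i, InTree f n m (j + d + 1) i → Splits f n m j (i / 2 ^ (d + 1)) := by
  induction d with
  | zero => intro i h; simpa using h.2
  | succ d ih =>
    intro i h
    have h1 : InTree f n m (j + d + 1) (i / 2) := h.1
    have := ih _ h1
    rwa [Nat.div_div_eq_div_mul, ← pow_succ'] at this

lemma card_le_leafCount (f : ℕ → ℝ) (n m : ℕ) (h : ℕ) :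
    ∀ j i, j + h = m → ∀ S : Finset (ℕ × ℕ),
      (∀ p ∈ S, IsLeaf f n m p.1 p.2 ∧ j ≤ p.1 ∧ p.2 / 2 ^ (p.1 - j) = i) →
      S.card ≤ leafCount f n m h j i := by
  have key : ∀ j i, ¬ Splits f n m j i → ∀ S : Finset (ℕ × ℕ),
      (∀ p ∈ S, IsLeaf f n m p.1 p.2 ∧ j ≤ p.1 ∧ p.2 / 2 ^ (p.1 - j) = i) →
      S.card ≤ 1 := by
    intro j i hns S hS
    have : S ⊆ {(j, i)} := by
      rintro ⟨a, b⟩ hp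
      obtain ⟨h1, h2, h3⟩ := hS _ hp
      simp only at h1 h2 h3
      obtain ⟨d, rfl⟩ := Nat.exists_eq_add_of_le h2
      cases d with
      | zero => simp at h3; simp [h3]
      | succ d =>
        exfalso
        have := inTree_anc f n m j d b h1.1
        apply hns
        rw [← h3]
        simpa using this
    simpa using Finset.card_le_card this
  induction h with
  | zero =>
    intro j i hj S hS
    exact key j i (fun hs => by have := hs.1; omega) S hS
  | succ h ih =>
    intro j i hj S hS
    by_cases hs : Splits f n m j i
    · have e : leafCount f n m (h + 1) j i = leafCount f n m h (j + 1) (2 * i) +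
          leafCount f n m h (j + 1) (2 * i + 1) := by simp [leafCount, hs]
      rw [e]
      have hS' : ∀ p ∈ S, j + 1 ≤ p.1 ∧ p.2 / 2 ^ (p.1 - (j + 1)) / 2 = i := by
        rintro ⟨a, b⟩ hp
        obtain ⟨h1, h2, h3⟩ := hS _ hp
        simp only at h1 h2 h3
        obtain ⟨d, rfl⟩ := Nat.exists_eq_add_of_le h2
        cases d with
        | zero => simp at h3; subst h3; exact absurd hs h1.2
        | succ d =>
          simp only
          refine ⟨by omega, ?_⟩
          rw [Nat.div_div_eq_div_mul, ← pow_succ, ← h3]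
          congr 2
          omega
      rw [← Finset.card_filter_add_card_filter_not (s := S)
        (fun p : ℕ × ℕ => p.2 / 2 ^ (p.1 - (j + 1)) = 2 * i)]
      apply add_le_add
      · apply ih (j + 1) (2 * i) (by omega)
        intro p hp
        rw [Finset.mem_filter] at hp
        exact ⟨(hS p hp.1).1, (hS' p hp.1).1, hp.2⟩
      · apply ih (j + 1) (2 * i + 1) (by omega)
        intro p hp
        rw [Finset.mem_filter] at hp
        have := hS' p hp.1
        refine ⟨(hS p hp.1).1, this.1, ?_⟩
        have h2 := hp.2
        omega
    · have e : leafCount f n m (h + 1) j i = 1 := by simp [leafCount, hs]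
      rw [e]
      exact key j i hs S hS

lemma leafCount_pos (f : ℕ → ℝ) (n m h : ℕ) : ∀ j i, 1 ≤ leafCount f n m h j i := by
  induction h with
  | zero => intro j i; simp [leafCount]
  | succ h ih =>
    intro j i
    unfold leafCount
    split_ifs
    · have := ih (j + 1) (2 * i); omega
    · exact le_rfl

lemma leafCount_le (f : ℕ → ℝ) (n m h : ℕ) :
    ∀ j i, leafCount f n m (h + 1) j i ≤ leafCount f n m h (j + 1) (2 * i) +
          leafCount f n m h (j + 1) (2 * i + 1) := by
  intro j i
  rw [leafCount]
  split_ifs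
  · exact le_rfl
  · have := leafCount_pos f n m h (j + 1) (2 * i); omega

lemma leafCount_le_pow (f : ℕ → ℝ) (n m h : ℕ) :
    ∀ j i, leafCount f n m h j i ≤ 2 ^ h := by
  induction h with
  | zero => intro j i; simp [leafCount]
  | succ h ih =>
    intro j i
    have h1 := leafCount_le f n m h j i
    have h2 := ih (j + 1) (2 * i)
    have h3 := ih (j + 1) (2 * i + 1)
    rw [pow_succ]; omega

lemma splitCount_add (f : ℕ → ℝ) (n m j p l l' : ℕ) :
    splitCount f n m j p (l + l') = splitCount f n m j p l + splitCount f n m j (p + l) l' := by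
  classical
  induction l' with
  | zero => simp [splitCount]
  | succ l' ih =>
    simp only [splitCount] at *
    rw [← add_assoc, Finset.range_add_one, Finset.range_add_one, Finset.filter_insert,
      Finset.filter_insert]
    split_ifs with h1 h2 h2
    · rw [Finset.card_insert_of_notMem (by simp), Finset.card_insert_of_notMem (by simp)]
      omega
    · exact absurd (by rwa [← add_assoc] at h1) h2
    · exact absurd (by rwa [← add_assoc]) h1
    · exact ih

lemma splitCount_le (f : ℕ → ℝ) (n m j p l : ℕ) : splitCount f n m j p l ≤ l := by
  classical
  unfold splitCount
  exact (Finset.card_filter_le _ _).trans (by simp)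

lemma leafCount_le_sum (f : ℕ → ℝ) (n m h : ℕ) :
    ∀ j i, leafCount f n m h j i ≤
      1 + ∑ b ∈ Finset.range h, splitCount f n m (j + b) (i * 2 ^ b) (2 ^ b) := by
  induction h with
  | zero => intro j i; simp [leafCount]
  | succ h ih =>
    intro j i
    by_cases hs : Splits f n m j i
    · have e : leafCount f n m (h + 1) j i = leafCount f n m h (j + 1) (2 * i) +
          leafCount f n m h (j + 1) (2 * i + 1) := by simp [leafCount, hs]
      rw [e, Finset.sum_range_succ']
      have h1 := ih (j + 1) (2 * i)
      have h2 := ih (j + 1) (2 * i + 1)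
      have h3 : splitCount f n m (j + 0) (i * 2 ^ 0) (2 ^ 0) = 1 := by
        simp [splitCount, Finset.filter_singleton, hs]
      have h4 : ∑ b ∈ Finset.range h,
            splitCount f n m (j + (b + 1)) (i * 2 ^ (b + 1)) (2 ^ (b + 1)) =
          ∑ b ∈ Finset.range h, splitCount f n m (j + 1 + b) (2 * i * 2 ^ b) (2 ^ b) +
          ∑ b ∈ Finset.range h, splitCount f n m (j + 1 + b) ((2 * i + 1) * 2 ^ b) (2 ^ b) := by
        rw [← Finset.sum_add_distrib]
        apply Finset.sum_congr rfl
        intro b _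
        rw [show 2 ^ (b + 1) = 2 ^ b + 2 ^ b by ring, splitCount_add]
        congr 2 <;> ring
      rw [h3, h4]
      omega
    · have e : leafCount f n m (h + 1) j i = 1 := by simp [leafCount, hs]
      omega

lemma leafCount_path (f : ℕ → ℝ) (n m T : ℕ) (N : ℕ) :
    ∀ j, leafCount f n m (T + N) j 0 ≤ 2 ^ T +
      ∑ r ∈ Finset.range N, leafCount f n m (T + r) (j + N - r) 1 := by
  induction N with
  | zero => intro j; simpa using leafCount_le_pow f n m T j 0
  | succ N ih =>
    intro j
    have h1 := leafCount_le f n m (T + N) j 0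
    have h2 := ih (j + 1)
    rw [Finset.sum_range_succ, ← add_assoc]
    simp only [mul_zero, zero_add] at h1
    have h3 : ∑ r ∈ Finset.range N, leafCount f n m (T + r) (j + 1 + N - r) 1 =
        ∑ r ∈ Finset.range N, leafCount f n m (T + r) (j + (N + 1) - r) 1 := by
      apply Finset.sum_congr rfl
      intro b _
      congr 1
      omega
    have h4 : j + (N + 1) - N = j + 1 := by omega
    rw [h4]
    omega

/-- Sum over geometric scales. -/
lemma scale_sum (N : ℕ) : ∀ (D : ℝ) (s : ℕ → ℝ), 0 ≤ D →
    (∀ b, b < N → 0 ≤ s b ∧ s b ≤ 2 ^ b ∧ s b ^ 2 * 2 ^ b ≤ D ^ 6) →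
    (D ≤ 1 → ∑ b ∈ Finset.range N, s b ≤ 3.5 * D ^ 3) ∧
    (1 ≤ D → ∑ b ∈ Finset.range N, s b ≤ 5 * D ^ 2 - 1) := by
  induction N with
  | zero =>
    intro D s hD _
    simp only [Finset.range_zero, Finset.sum_empty]
    exact ⟨fun _ => by positivity, fun h => by nlinarith⟩
  | succ N ih =>
    intro D s hD hs
    set q := Real.sqrt 2 with hq
    have q2 : q ^ 2 = 2 := Real.sq_sqrt (by norm_num)
    have q0 : 0 < q := Real.sqrt_pos.mpr (by norm_num)
    have q1 : 1.414 ≤ q := by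
      apply Real.le_sqrt_of_sq_le; norm_num
    have q1' : q ≤ 1.415 := by
      rw [hq, Real.sqrt_le_left (by norm_num)]; norm_num
    have q6 : q ^ 6 = 8 := by
      calc q ^ 6 = (q ^ 2) ^ 3 := by ring
        _ = 8 := by rw [q2]; norm_num
    have q3 : q ^ 3 = 2 * q := by
      calc q ^ 3 = (q ^ 2) * q := by ring
        _ = 2 * q := by rw [q2]
    have IH := ih (D / q) (fun b => s (b + 1) / 2) (by positivity) (by
      intro b hb
      obtain ⟨h1, h2, h3⟩ := hs (b + 1) (by omega)
      refine ⟨by positivity, ?_, ?_⟩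
      · rw [pow_succ] at h2
        linarith
      · rw [div_pow, div_pow, q6]
        rw [pow_succ 2 b] at h3
        linarith)
    rw [Finset.sum_range_succ', ← Finset.sum_div] at *
    set W := ∑ b ∈ Finset.range N, s (b + 1)
    obtain ⟨a1, a2, a3⟩ := hs 0 (by omega)
    simp only [pow_zero, mul_one] at a2 a3
    have a4 : s 0 ≤ D ^ 3 := by
      refine (sq_le_sq₀ a1 (by positivity)).1 ?_
      linarith [show (D ^ 3) ^ 2 = D ^ 6 by ring]
    obtain ⟨I1, I2⟩ := IH
    rw [div_pow, q3] at I1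
    rw [div_pow, q2] at I2
    have e : D ^ 3 / (2 * q) ≤ D ^ 3 * 0.354 := by
      rw [div_le_iff₀ (by positivity)]
      have : 0 ≤ D ^ 3 := by positivity
      nlinarith
    refine ⟨fun h => ?_, fun h => ?_⟩
    · have := I1 (by rw [div_le_one q0]; linarith)
      have : 0 ≤ D ^ 3 := by positivity
      linarith
    · by_cases hD2 : D ≤ q
      · have := I1 (by rw [div_le_one q0]; linarith)
        have h5 : 2 + 2.478 * D ^ 3 ≤ 5 * D ^ 2 := by
          have : D ≤ 1.415 := by linarith
          nlinarith [mul_nonneg (sub_nonneg.2 h) (sub_nonneg.2 this), sq_nonneg (D - 1), mul_nonneg hD (mul_nonneg (sub_nonneg.2 h) (sub_nonneg.2 this))]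
        linarith
      · have := I2 (by rw [le_div_iff₀ q0]; linarith)
        linarith

lemma block_shift (f : ℕ → ℝ) (m j i : ℕ) :
    blockSum f m j i = ∑ r ∈ Finset.range (2 ^ (m - j)), f (i * 2 ^ (m - j) + 1 + r) := by
  unfold blockSum nodeInterval
  rw [← Finset.Ico_add_one_right_eq_Icc, Finset.sum_Ico_eq_sum_range]
  congr 2
  rw [add_mul]; omega

section
variable {m : ℕ} {f : ℕ → ℝ}

lemma f_anti (hmono : ∀ x, 1 ≤ x → x + 1 ≤ 2 ^ m → f (x + 1) ≤ f x) (x d : ℕ) (hx : 1 ≤ x)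
    (h : x + d ≤ 2 ^ m) : f (x + d) ≤ f x := by
  induction d with
  | zero => exact le_rfl
  | succ d ih => exact (hmono (x + d) (by omega) (by omega)).trans (ih (by omega))

lemma block_anti (hmono : ∀ x, 1 ≤ x → x + 1 ≤ 2 ^ m → f (x + 1) ≤ f x) (j i : ℕ) (hj : j ≤ m)
    (hi : i + 2 ≤ 2 ^ j) : blockSum f m j (i + 1) ≤ blockSum f m j i := by
  rw [block_shift, block_shift]
  apply Finset.sum_le_sum
  intro r hr
  rw [Finset.mem_range] at hr
  have e : (i + 1) * 2 ^ (m - j) + 1 + r = i * 2 ^ (m - j) + 1 + r + 2 ^ (m - j) := by ring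
  rw [e]
  apply f_anti hmono _ _ (by omega)
  have h1 : (i + 2) * 2 ^ (m - j) ≤ 2 ^ j * 2 ^ (m - j) := Nat.mul_le_mul_right _ hi
  rw [← pow_add, Nat.add_sub_cancel' hj, add_mul] at h1
  omega

lemma block_nonneg (hf0 : ∀ x, 0 ≤ f x) (j i : ℕ) : 0 ≤ blockSum f m j i :=
  Finset.sum_nonneg (fun _ _ => hf0 _)

lemma sqrt_step (a b N : ℝ) (ha : 0 ≤ a) (hb : 0 ≤ b) (hN : 0 < N)
    (h : a - b > Real.sqrt ((a + b) / N)) : Real.sqrt b + 1 / Real.sqrt (2 * N) ≤ Real.sqrt a := by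
  have hx := Real.sqrt_nonneg a
  have hy := Real.sqrt_nonneg b
  have hx2 := Real.sq_sqrt ha
  have hy2 := Real.sq_sqrt hb
  set x := Real.sqrt a
  set y := Real.sqrt b
  have hab : 0 < a - b := lt_of_le_of_lt (Real.sqrt_nonneg _) h
  have h2 : (a + b) / N < (a - b) ^ 2 := by
    rwa [gt_iff_lt, Real.sqrt_lt' hab] at h
  have hxy : y < x := by nlinarith
  have h3 : 1 / Real.sqrt (2 * N) ≤ x - y := by
    rw [one_div, ← Real.sqrt_inv]
    rw [Real.sqrt_le_left (by linarith)]
    rw [inv_le_iff_one_le_mul₀ (by positivity)]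
    rw [div_lt_iff₀ hN] at h2
    have h4 : (a + b) ≤ (a + b) * ((x - y) ^ 2 * (2 * N)) := by
      have e1 : (a - b) ^ 2 = (x - y) ^ 2 * (x + y) ^ 2 := by rw [← hx2, ← hy2]; ring
      have e2 : (x + y) ^ 2 ≤ 2 * (a + b) := by nlinarith [sq_nonneg (x - y)]
      have e3 : 0 ≤ (x - y) ^ 2 * N := by positivity
      rw [e1] at h2
      nlinarith [mul_le_mul_of_nonneg_left e2 e3]
    have h5 : 0 < a + b := by linarith
    nlinarith
  linarith

lemma split_bound (hf0 : ∀ x, 0 ≤ f x)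
    (hmono : ∀ x, 1 ≤ x → x + 1 ≤ 2 ^ m → f (x + 1) ≤ f x) (n : ℕ) (hn : 0 < n) (j : ℕ)
    (hj : j < m) (l : ℕ) : ∀ p, p + l ≤ 2 ^ j → 
    (splitCount f n m j p l : ℝ) * (1 / Real.sqrt (2 * n)) ≤
      Real.sqrt (blockSum f m (j + 1) (2 * p)) := by
  induction l with
  | zero => intro p _; simp [splitCount]
  | succ l ih =>
    intro p hp
    have hN : (0 : ℝ) < n := by exact_mod_cast hn
    rw [add_comm l 1, splitCount_add]
    have ih' := ih (p + 1) (by omega)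
    have hpow : 2 ^ (j + 1) = 2 * 2 ^ j := by ring
    have m1 : blockSum f m (j + 1) (2 * p + 1) ≤ blockSum f m (j + 1) (2 * p) :=
      block_anti hmono _ _ (by omega) (by omega)
    have c1 : (splitCount f n m j (p + 1) l : ℝ) * (1 / Real.sqrt (2 * n)) ≤
        Real.sqrt (blockSum f m (j + 1) (2 * p + 1)) := by
      rcases Nat.eq_zero_or_pos l with h0 | h0
      · subst h0
        simp [splitCount]
      · refine ih'.trans (Real.sqrt_le_sqrt ?_)
        exact block_anti hmono _ (2 * p + 1) (by omega) (by omega)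
    push_cast
    rw [add_mul]
    by_cases hs : Splits f n m j p
    · have e : splitCount f n m j p 1 = 1 := by
        simp [splitCount, Finset.filter_singleton, hs]
      have := sqrt_step _ _ n (block_nonneg hf0 _ _) (block_nonneg hf0 _ _) hN hs.2
      rw [e, Nat.cast_one, one_mul]
      linarith
    · have e : splitCount f n m j p 1 = 0 := by
        simp [splitCount, Finset.filter_singleton, hs]
      rw [e, Nat.cast_zero, zero_mul, zero_add]
      exact c1.trans (Real.sqrt_le_sqrt m1)

/-- The bound on splits in zone `t` at relative depth `b`. -/
lemma zone_level (hf0 : ∀ x, 0 ≤ f x)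
    (hmono : ∀ x, 1 ≤ x → x + 1 ≤ 2 ^ m → f (x + 1) ≤ f x) (n : ℕ) (hn : 0 < n) (t b : ℕ)
    (ht : t < m) (hb : b < t) :
    (splitCount f n m (m - t + b) (1 * 2 ^ b) (2 ^ b) : ℝ) ^ 2 * 2 ^ b ≤
      2 * n * ∑ r ∈ Finset.range (2 ^ (t - 1)), f (2 ^ (t - 1) + 1 + r) := by
  have hN : (0 : ℝ) < n := by exact_mod_cast hn
  have h1 := split_bound hf0 hmono n hn (m - t + b) (by omega) (2 ^ b) (1 * 2 ^ b) (by
    have : 2 ^ (b + 1) ≤ 2 ^ (m - t + b) := Nat.pow_le_pow_right (by norm_num) (by omega)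
    rw [pow_succ] at this; omega)
  have hg0 : 0 ≤ blockSum f m (m - t + b + 1) (2 * (1 * 2 ^ b)) := block_nonneg hf0 _ _
  rw [mul_one_div, div_le_iff₀ (by positivity), ← Real.sqrt_mul hg0,
    Real.le_sqrt (by positivity) (by positivity)] at h1
  have e1 : m - (m - t + b + 1) = t - 1 - b := by omega
  have e2 : 2 * (1 * 2 ^ b) * 2 ^ (t - 1 - b) = 2 ^ t := by
    rw [one_mul, ← pow_succ', ← pow_add]; congr 1; omega
  have htm : 2 ^ t + 2 ^ t ≤ 2 ^ m := by
    have : 2 ^ (t + 1) ≤ 2 ^ m := Nat.pow_le_pow_right (by norm_num) (by omega)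
    rw [pow_succ] at this; omega
  have htt : 2 ^ (t - 1) + 2 ^ (t - 1) = 2 ^ t := by
    rw [← mul_two, ← pow_succ]; congr 1; omega
  have g1 : blockSum f m (m - t + b + 1) (2 * (1 * 2 ^ b)) ≤ 2 ^ (t - 1 - b) * f (2 ^ t) := by
    rw [block_shift, e1, e2]
    calc _ ≤ ∑ r ∈ Finset.range (2 ^ (t - 1 - b)), f (2 ^ t) := by
          apply Finset.sum_le_sum
          intro r hr
          rw [Finset.mem_range] at hr
          rw [add_assoc]
          apply f_anti hmono _ _ Nat.one_le_two_pow
          have : 2 ^ (t - 1 - b) ≤ 2 ^ t := Nat.pow_le_pow_right (by norm_num) (by omega)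
          omega
      _ = _ := by simp
  have g2 : 2 ^ (t - 1) * f (2 ^ t) ≤
      ∑ r ∈ Finset.range (2 ^ (t - 1)), f (2 ^ (t - 1) + 1 + r) := by
    calc _ = ∑ r ∈ Finset.range (2 ^ (t - 1)), f (2 ^ t) := by simp
      _ ≤ _ := by
          apply Finset.sum_le_sum
          intro r hr
          rw [Finset.mem_range] at hr
          have := f_anti hmono (2 ^ (t - 1) + 1 + r) (2 ^ t - (2 ^ (t - 1) + 1 + r)) (by omega)
            (by omega)
          rwa [Nat.add_sub_cancel' (by omega)] at this
  have g3 : (2 : ℝ) ^ (t - 1 - b) * 2 ^ b = 2 ^ (t - 1) := by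
    rw [← pow_add]; congr 1; omega
  have hb0 : (0 : ℝ) < 2 ^ b := by positivity
  calc _ ≤ (blockSum f m (m - t + b + 1) (2 * (1 * 2 ^ b)) * (2 * n)) * 2 ^ b :=
        mul_le_mul_of_nonneg_right h1 hb0.le
    _ ≤ ((2 ^ (t - 1 - b) * f (2 ^ t)) * (2 * n)) * 2 ^ b := by gcongr
    _ = 2 * n * (2 ^ (t - 1) * f (2 ^ t)) := by rw [← g3]; ring
    _ ≤ _ := by gcongr

lemma zone_mass (N : ℕ) : ∀ T, 1 ≤ T →
    ∑ x ∈ Finset.range (2 ^ (T - 1)), f (1 + x) +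
    ∑ r ∈ Finset.range N,
      ∑ x ∈ Finset.range (2 ^ (T + r - 1)), f (2 ^ (T + r - 1) + 1 + x) =
    ∑ x ∈ Finset.range (2 ^ (T + N - 1)), f (1 + x) := by
  intro T hT
  induction N with
  | zero => simp
  | succ N ih =>
    rw [Finset.sum_range_succ, ← add_assoc, ih]
    have : 2 ^ (T + (N + 1) - 1) = 2 ^ (T + N - 1) + 2 ^ (T + N - 1) := by
      rw [← mul_two, ← pow_succ]; congr 1; omega
    rw [this, Finset.sum_range_add]
    congr 1
    apply Finset.sum_congr rfl
    intro x _
    congr 1; omega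

lemma zone_count (hf0 : ∀ x, 0 ≤ f x)
    (hmono : ∀ x, 1 ≤ x → x + 1 ≤ 2 ^ m → f (x + 1) ≤ f x) (n : ℕ) (hn : 0 < n) (t : ℕ)
    (ht : t < m) (y : ℝ) (hy : 0 < y) :
    (leafCount f n m t (m - t) 1 : ℝ) ≤ 1 + 5 / 3 * (2 * n *
      (∑ r ∈ Finset.range (2 ^ (t - 1)), f (2 ^ (t - 1) + 1 + r)) / y ^ 2 + 2 * y) := by
  have h1 : (leafCount f n m t (m - t) 1 : ℝ) ≤ 1 + ∑ b ∈ Finset.range t,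
      (splitCount f n m (m - t + b) (1 * 2 ^ b) (2 ^ b) : ℝ) := by
    exact_mod_cast leafCount_le_sum f n m t (m - t) 1
  set M := ∑ r ∈ Finset.range (2 ^ (t - 1)), f (2 ^ (t - 1) + 1 + r) with hM
  have hM0 : 0 ≤ M := Finset.sum_nonneg (fun _ _ => hf0 _)
  set D : ℝ := (2 * n * M) ^ ((1 : ℝ) / 6) with hDdef
  have hD0 : 0 ≤ D := by positivity
  have hD6 : D ^ 6 = 2 * n * M := by
    rw [hDdef, ← Real.rpow_natCast, ← Real.rpow_mul (by positivity)]
    norm_num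
  have h2 := scale_sum t D
    (fun b => (splitCount f n m (m - t + b) (1 * 2 ^ b) (2 ^ b) : ℝ)) hD0 (by
      intro b hb
      refine ⟨by positivity, ?_, ?_⟩
      · exact_mod_cast splitCount_le f n m (m - t + b) (1 * 2 ^ b) (2 ^ b)
      · rw [hD6]
        exact zone_level hf0 hmono n hn t b ht hb)
  have h3 : ∑ b ∈ Finset.range t,
      (splitCount f n m (m - t + b) (1 * 2 ^ b) (2 ^ b) : ℝ) ≤ 5 * D ^ 2 := by
    rcases le_total D 1 with h | h
    · have := h2.1 h
      have h4 : D ^ 3 ≤ D ^ 2 := pow_le_pow_of_le_one hD0 h (by norm_num)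
      have : 0 ≤ D ^ 2 := by positivity
      linarith
    · have := h2.2 h
      linarith
  have h4 : D ^ 2 ≤ 1 / 3 * (2 * n * M / y ^ 2 + 2 * y) := by
    rw [← hD6]
    have : D ^ 2 * y ^ 2 * 3 ≤ D ^ 6 + 2 * y ^ 3 := by
      have hB : 0 ≤ D ^ 2 := by positivity
      have : D ^ 6 = (D ^ 2) ^ 3 := by ring
      rw [this]
      nlinarith [mul_nonneg (by positivity : 0 ≤ D ^ 2 + 2 * y) (sq_nonneg (D ^ 2 - y))]
    have e : 1 / 3 * (D ^ 6 / y ^ 2 + 2 * y) = (D ^ 6 + 2 * y ^ 3) / (3 * y ^ 2) := by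
      field_simp
    rw [e, le_div_iff₀ (by positivity)]
    linarith
  linarith

end

/-- **Proposition 3.2**: for `k = 2^m` a power of two and `f` a non-increasing
probability density on `{1, …, k}`, if `n ≥ 64` and `2 n^{1/3} ≤ k < n^{1/3} 2^n`,
then the leaf set `L*` of the idealized tree `T*(f)` satisfies
`|L*| ≤ 12 n^{1/3} (log₂(k / n^{1/3}))^{2/3}`. -/
theorem stmt6 (m n : ℕ) (hn : 64 ≤ n) (f : ℕ → ℝ)
    (hf0 : ∀ x, 0 ≤ f x)
    (hf1 : ∑ x ∈ Finset.Icc 1 (2 ^ m), f x = 1)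
    (hmono : ∀ x, 1 ≤ x → x + 1 ≤ 2 ^ m → f (x + 1) ≤ f x)
    (hk1 : 2 * (n : ℝ) ^ ((1 : ℝ) / 3) ≤ (2 : ℝ) ^ m)
    (hk2 : (2 : ℝ) ^ m < (n : ℝ) ^ ((1 : ℝ) / 3) * 2 ^ n)
    (L : Finset (ℕ × ℕ))
    (hL : ∀ p : ℕ × ℕ, p ∈ L ↔ IsLeaf f n m p.1 p.2) :
    (L.card : ℝ) ≤
      12 * (n : ℝ) ^ ((1 : ℝ) / 3) *
        (Real.logb 2 ((2 : ℝ) ^ m / (n : ℝ) ^ ((1 : ℝ) / 3))) ^ ((2 : ℝ) / 3) := by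
  have hN : (0 : ℝ) < n := by exact_mod_cast (by omega : 0 < n)
  set g : ℝ := (n : ℝ) ^ ((1 : ℝ) / 3) with hg
  have hg0 : 0 < g := by positivity
  have hg3 : g ^ 3 = n := by
    rw [hg, ← Real.rpow_natCast, ← Real.rpow_mul hN.le]; norm_num
  have hn64 : (64 : ℝ) ≤ n := by exact_mod_cast hn
  have hg4 : 4 ≤ g := by
    by_contra h
    push Not at h
    have : g ^ 3 < 4 ^ 3 := pow_lt_pow_left₀ h hg0.le (by norm_num)
    rw [hg3] at this
    linarith
  set c : ℝ := Real.logb 2 ((2 : ℝ) ^ m / g) with hc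
  have hcm : (2 : ℝ) ^ c = 2 ^ m / g :=
    Real.rpow_logb (by norm_num) (by norm_num) (by positivity)
  have hc1 : 1 ≤ c := by
    rw [hc, Real.le_logb_iff_rpow_le (by norm_num) (by positivity), Real.rpow_one,
      le_div_iff₀ hg0]
    exact hk1
  have hcn : c ≤ n := by
    rw [hc, Real.logb_le_iff_le_rpow (by norm_num) (by positivity), Real.rpow_natCast,
      div_le_iff₀ hg0]
    linarith
  set e : ℝ := c ^ ((1 : ℝ) / 3) with he
  have he0 : 0 < e := by positivity
  have he3 : e ^ 3 = c := by
    rw [he, ← Real.rpow_natCast, ← Real.rpow_mul (by linarith)]; norm_num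
  have he2 : c ^ ((2 : ℝ) / 3) = e ^ 2 := by
    rw [he, ← Real.rpow_natCast, ← Real.rpow_mul (by linarith)]; norm_num
  have he1 : 1 ≤ e := Real.one_le_rpow hc1 (by norm_num)
  have heg : e ≤ g := Real.rpow_le_rpow (by linarith) hcn (by norm_num)
  rw [he2]
  -- choose T
  obtain ⟨T, hT1, hT2⟩ : ∃ T : ℕ, g ≤ 2 ^ T ∧ (2 : ℝ) ^ T ≤ 2 * g := by
    obtain ⟨T, h1, h2⟩ := exists_nat_pow_near (by linarith : 1 ≤ g) (by norm_num : (1 : ℝ) < 2)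
    exact ⟨T + 1, h2.le, by rw [pow_succ]; linarith⟩
  have hT0 : 1 ≤ T := by
    rcases Nat.eq_zero_or_pos T with h | h
    · subst h; norm_num at hT1; linarith
    · exact h
  have hTm : T ≤ m := by
    have : (2 : ℝ) ^ T ≤ 2 ^ m := by linarith
    exact (pow_le_pow_iff_right₀ (by norm_num)).1 this
  obtain ⟨N, rfl⟩ : ∃ N, m = T + N := ⟨m - T, by omega⟩
  have hNc : (N : ℝ) ≤ c := by
    rw [hc, Real.le_logb_iff_rpow_le (by norm_num) (by positivity), Real.rpow_natCast,
      le_div_iff₀ hg0, pow_add]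
    have : (0 : ℝ) < 2 ^ N := by positivity
    nlinarith
  have hcard : L.card ≤ leafCount f n (T + N) (T + N) 0 0 := by
    apply card_le_leafCount f n (T + N) (T + N) 0 0 (by omega)
    intro p hp
    have hp' := (hL p).1 hp
    refine ⟨hp', by omega, ?_⟩
    have : ∀ j i, InTree f n (T + N) j i → i / 2 ^ j = 0 := by
      intro j
      induction j with
      | zero => intro i h; simpa [InTree] using h
      | succ j ih =>
        intro i h
        have := ih _ h.1
        rwa [Nat.div_div_eq_div_mul, ← pow_succ'] at this
    simpa using this _ _ hp'.1
  have hpath := leafCount_path f n (T + N) T N 0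
  set M : ℕ → ℝ := fun r =>
    ∑ x ∈ Finset.range (2 ^ (T + r - 1)), f (2 ^ (T + r - 1) + 1 + x) with hMdef
  have hmass : ∑ r ∈ Finset.range N, M r ≤ 1 := by
    have h1 := zone_mass (f := f) N T hT0
    have h2 : 0 ≤ ∑ x ∈ Finset.range (2 ^ (T - 1)), f (1 + x) :=
      Finset.sum_nonneg (fun _ _ => hf0 _)
    have h3 : ∑ x ∈ Finset.range (2 ^ (T + N - 1)), f (1 + x) ≤
        ∑ x ∈ Finset.range (2 ^ (T + N)), f (1 + x) := by
      apply Finset.sum_le_sum_of_subset_of_nonneg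
      · apply Finset.range_subset_range.2
        exact Nat.pow_le_pow_right (by norm_num) (by omega)
      · intros; exact hf0 _
    have h4 : ∑ x ∈ Finset.range (2 ^ (T + N)), f (1 + x) = 1 := by
      rw [← hf1, ← Finset.Ico_add_one_right_eq_Icc, Finset.sum_Ico_eq_sum_range]
      simp
    simp only [hMdef]
    linarith
  set y : ℝ := g / e with hy
  have hy0 : 0 < y := by positivity
  have hz : ∀ r ∈ Finset.range N, (leafCount f n (T + N) (T + r) (0 + N - r) 1 : ℝ) ≤
      1 + 5 / 3 * (2 * n * M r / y ^ 2 + 2 * y) := by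
    intro r hr
    rw [Finset.mem_range] at hr
    have := zone_count hf0 hmono n (by omega) (T + r) (by omega) y hy0
    rwa [show T + N - (T + r) = 0 + N - r by omega] at this
  have hsum := Finset.sum_le_sum hz
  have hEq : ∑ r ∈ Finset.range N, (1 + 5 / 3 * (2 * n * M r / y ^ 2 + 2 * y)) =
      N + 5 / 3 * (2 * n / y ^ 2 * ∑ r ∈ Finset.range N, M r + N * (2 * y)) := by
    rw [Finset.sum_add_distrib, ← Finset.mul_sum, Finset.sum_add_distrib, Finset.mul_sum]
    simp only [Finset.sum_const, Finset.card_range, nsmul_eq_mul, mul_one]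
    congr 4
    funext r
    ring
  rw [hEq] at hsum
  have hfin : (L.card : ℝ) ≤ 2 ^ T +
      ∑ r ∈ Finset.range N, (leafCount f n (T + N) (T + r) (0 + N - r) 1 : ℝ) := by
    exact_mod_cast hcard.trans hpath
  have k1 : 2 * n / y ^ 2 * ∑ r ∈ Finset.range N, M r ≤ 2 * n / y ^ 2 * 1 := by gcongr
  have k2 : 2 * n / y ^ 2 * 1 = 2 * (g * e ^ 2) := by
    rw [hy, ← hg3]; field_simp
  have k3 : N * (2 * y) ≤ 2 * (g * e ^ 2) := by
    calc N * (2 * y) ≤ c * (2 * y) := by gcongr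
      _ = _ := by rw [hy, ← he3]; field_simp
  have k4 : c ≤ g * e ^ 2 := by
    rw [← he3]; nlinarith [sq_nonneg e]
  have k5 : g ≤ g * e ^ 2 := le_mul_of_one_le_right hg0.le (one_le_pow₀ he1)
  linarith
end

section
/- Let k be a power of 3 and f a non-increasing convex probability density on {1,…,k}. If n ≥ 3^{10} and 3 n^{1/5} ≤ k < n^{1/5} 3^n, then the number of leaves of the idealized ternary tree satisfies |L†| ≤ 34 n^{1/5} (log₃(k/n^{1/5}))^{4/5}. -/
open Finset

/-- For `k = 3^m`, the node at depth `j` and position `i` (for `i < 3^j`) of the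
complete ternary tree of triadic subintervals of `{1, …, 3^m}` covers the interval
`I_{j,i} = {i · 3^{m-j} + 1, …, (i+1) · 3^{m-j}}`. -/
def nodeInterval3 (m j i : ℕ) : Finset ℕ :=
  Finset.Icc (i * 3 ^ (m - j) + 1) ((i + 1) * 3 ^ (m - j))

/-- `f_{I_{j,i}} = ∑_{x ∈ I_{j,i}} f x`, the mass of `f` on the interval of node `(j, i)`. -/
noncomputable def blockSum3 (f : ℕ → ℝ) (m j i : ℕ) : ℝ :=
  ∑ x ∈ nodeInterval3 m j i, f x

/-- The idealized ternary splitting rule: the node `(j, i)` splits iff its interval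
has more than one point (i.e. `j < m`) and, with `I_v`, `I_w`, `I_r` the three equal
consecutive thirds of its interval from left to right,
`f_{I_v} - 2 f_{I_w} + f_{I_r} > √((f_{I_v} + f_{I_w} + f_{I_r})/n)`. -/
def Splits3 (f : ℕ → ℝ) (n m j i : ℕ) : Prop :=
  j < m ∧
    blockSum3 f m (j + 1) (3 * i) - 2 * blockSum3 f m (j + 1) (3 * i + 1) +
        blockSum3 f m (j + 1) (3 * i + 2) >
      Real.sqrt ((blockSum3 f m (j + 1) (3 * i) + blockSum3 f m (j + 1) (3 * i + 1) +
        blockSum3 f m (j + 1) (3 * i + 2)) / n)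

/-- Membership of the node `(j, i)` in the idealized ternary tree `T†(f)`: the root
`(0, 0)` is in the tree, and a node is in the tree iff its parent is in the tree and
splits. -/
def InTree3 (f : ℕ → ℝ) (n m : ℕ) : ℕ → ℕ → Prop
  | 0, i => i = 0
  | j + 1, i => InTree3 f n m j (i / 3) ∧ Splits3 f n m j (i / 3)

/-- The node `(j, i)` is a leaf of the idealized ternary tree `T†(f)`: it belongs to
the tree and does not split. -/
def IsLeaf3 (f : ℕ → ℝ) (n m j i : ℕ) : Prop :=
  InTree3 f n m j i ∧ ¬ Splits3 f n m j i


lemma recursion_aux (b : ℕ → ℝ) (n : ℝ) (hn : 0 < n) (hb : ∀ u, 0 ≤ b u)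
    (hd : ∀ u, 0 ≤ b u - b (u + 1))
    (hc : ∀ u, b (u + 1) - b (u + 2) ≤ b u - b (u + 1)) (T : Finset ℕ)
    (hT : ∀ i ∈ T, b (3 * i) - 2 * b (3 * i + 1) + b (3 * i + 2) >
      Real.sqrt ((b (3 * i) + b (3 * i + 1) + b (3 * i + 2)) / n)) :
    ∀ v, (∀ i ∈ T, v ≤ 3 * i) →
      (T.card : ℝ) ^ 4 / 36 ≤ n * b v ∧
      (T.card : ℝ) * (T.card + 1) * (2 * T.card + 1) / 36 ≤ n * (b v - b (v + 1)) := by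
  have hbanti : Antitone b := antitone_nat_of_succ_le (fun u => by linarith [hd u])
  have hdanti : Antitone (fun u => b u - b (u + 1)) := antitone_nat_of_succ_le hc
  induction T using Finset.induction_on_min with
  | empty =>
    intro v _
    simp only [card_empty, Nat.cast_zero]
    constructor
    · have := mul_nonneg hn.le (hb v); simpa using this
    · have := mul_nonneg hn.le (hd v); simpa using this
  | insert a s has ih =>
    intro v hv
    have hva : v ≤ 3 * a := hv a (mem_insert_self _ _)
    have hans : a ∉ s := fun h => lt_irrefl _ (has a h)
    obtain ⟨ih1, ih2⟩ := ih (fun i hi => hT i (mem_insert_of_mem hi)) (3 * a + 3)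
      (fun i hi => by have := has i hi; omega)
    have hTa := hT a (mem_insert_self _ _)
    rw [card_insert_of_notMem hans]
    push_cast
    set N : ℝ := (s.card : ℝ) with hN
    have hN0 : 0 ≤ N := Nat.cast_nonneg _
    have c0 := hc (3 * a)
    have c1 := hc (3 * a + 1)
    have c2 := hc (3 * a + 2)
    have e0 := hd (3 * a)
    have e1 := hd (3 * a + 1)
    have e2 := hd (3 * a + 2)
    have e3 := hd (3 * a + 3)
    simp only [add_assoc, Nat.reduceAdd] at *
    have hDpos : Real.sqrt (n * b (3 * a)) <
        n * (b (3 * a) - 2 * b (3 * a + 1) + b (3 * a + 2)) := by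
      have h1 : Real.sqrt (n * b (3 * a)) ≤
          n * Real.sqrt ((b (3 * a) + (b (3 * a + 1) + b (3 * a + 2))) / n) := by
        apply Real.sqrt_le_iff.2
        constructor
        · positivity
        · rw [mul_pow, Real.sq_sqrt (by have := hb (3*a); have := hb (3*a+1); have := hb (3*a+2); positivity)]
          have : n ^ 2 * ((b (3 * a) + (b (3 * a + 1) + b (3 * a + 2))) / n) =
              n * (b (3 * a) + (b (3 * a + 1) + b (3 * a + 2))) := by
            field_simp
          rw [this]
          apply mul_le_mul_of_nonneg_left _ hn.le
          linarith [hb (3*a+1), hb (3*a+2)]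
      have h2 := mul_lt_mul_of_pos_left hTa hn
      try simp only [add_assoc] at h2 ⊢
      linarith
    have key1 : (N + 1) ^ 4 / 36 ≤ n * b (3 * a) := by
      rcases Nat.eq_zero_or_pos s.card with h0 | h0
      · have hNz : N = 0 := by rw [hN, h0]; simp
        rw [hNz]
        have hle : n * (b (3 * a) - 2 * b (3 * a + 1) + b (3 * a + 2)) ≤ n * b (3 * a) := by
          apply mul_le_mul_of_nonneg_left _ hn.le
          linarith [hb (3*a+1), hb (3*a+2)]
        have hlt := lt_of_lt_of_le hDpos hle
        have hx : 0 ≤ n * b (3 * a) := mul_nonneg hn.le (hb _)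
        by_contra hcon
        push Not at hcon
        have : n * b (3 * a) ≤ Real.sqrt (n * b (3 * a)) := by
          apply Real.le_sqrt_of_sq_le
          nlinarith
        linarith
      · have h1 : (1 : ℝ) ≤ N := by rw [hN]; exact_mod_cast h0
        have h3 : n * b (3 * a + 3) + 3 * (n * (b (3 * a + 3) - b (3 * a + 4))) ≤ n * b (3 * a) := by
          have : b (3 * a + 3) + 3 * (b (3 * a + 3) - b (3 * a + 4)) ≤ b (3 * a) := by linarith
          nlinarith
        have h4 : (N + 1) ^ 4 / 36 ≤ N ^ 4 / 36 + 3 * (N * ((N + 1) * (2 * N + 1)) / 36) := by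
          have : 0 ≤ (N - 1) * (2 * N ^ 2 + 5 * N + 4) := by
            apply mul_nonneg <;> nlinarith
          nlinarith
        simp only [mul_assoc] at ih2
        linarith
    have key2 : (N + 1) * ((N + 1) + 1) * (2 * (N + 1) + 1) / 36 ≤
        n * (b (3 * a) - b (3 * a + 1)) := by
      have h1 : (N + 1) ^ 2 / 6 ≤ Real.sqrt (n * b (3 * a)) := by
        apply Real.le_sqrt_of_sq_le
        calc _ = (N + 1) ^ 4 / 36 := by ring
          _ ≤ _ := key1
      have h2 : n * (b (3 * a + 3) - b (3 * a + 4)) ≤ n * (b (3 * a + 1) - b (3 * a + 2)) := by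
        apply mul_le_mul_of_nonneg_left _ hn.le
        linarith
      nlinarith
    constructor
    · exact key1.trans (mul_le_mul_of_nonneg_left (hbanti hva) hn.le)
    · have := mul_le_mul_of_nonneg_left (hdanti hva) hn.le
      simp only [add_assoc] at key2 this ⊢
      exact key2.trans this

/-- Summing over levels in a ring. -/
lemma sum_levels (N : ℕ → ℝ) (y : ℝ) (hy : 0 ≤ y)
    (h1 : ∀ r, N r ≤ 2 * 3 ^ r) (h2 : ∀ r, N r ^ 3 * 9 ^ r ≤ 18 * y ^ 5)
    (hN : ∀ r, 0 ≤ N r) (R : ℕ) : ∑ r ∈ range R, N r ≤ 8.242 * y := by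
  have hex : ∃ r : ℕ, y < 3 ^ r := pow_unbounded_of_one_lt y (by norm_num)
  classical
  obtain ⟨r1, hr1, hmin⟩ : ∃ r1 : ℕ, y < 3 ^ r1 ∧ ∀ r < r1, (3 : ℝ) ^ r ≤ y := by
    refine ⟨Nat.find hex, Nat.find_spec hex, fun r hr => ?_⟩
    exact not_lt.1 (Nat.find_min hex hr)
  have hgeo : ∀ t : ℕ, ∑ r ∈ range t, (2 : ℝ) * 3 ^ r = 3 ^ t - 1 := by
    intro t
    induction t with
    | zero => simp
    | succ t ih => rw [sum_range_succ, ih]; ring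
  have hgeo2 : ∀ t : ℕ, ∑ r ∈ range t, (1 / 2 : ℝ) ^ r = 2 - 2 * (1 / 2) ^ t := by
    intro t
    induction t with
    | zero => simp
    | succ t ih => rw [sum_range_succ, ih]; ring
  have hlow : ∑ r ∈ range r1, N r ≤ 3 * y := by
    refine (sum_le_sum (fun r _ => h1 r)).trans ?_
    rw [hgeo]
    rcases Nat.eq_zero_or_pos r1 with h | h
    · subst h; simp; exact hy
    · obtain ⟨t, rfl⟩ : ∃ t, r1 = t + 1 := ⟨r1 - 1, by omega⟩
      have := hmin t (by omega)
      rw [pow_succ]; linarith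
  have htail : ∀ u, N (r1 + u) ≤ 2.621 * y * (1 / 2) ^ u := by
    intro u
    have a1 := h2 (r1 + u)
    have hn := hN (r1 + u)
    have a2 : y ^ 2 * 9 ^ u ≤ 9 ^ (r1 + u) := by
      rw [pow_add]
      apply mul_le_mul_of_nonneg_right _ (by positivity)
      calc y ^ 2 ≤ (3 ^ r1) ^ 2 := by gcongr
        _ = 9 ^ r1 := by rw [← pow_mul, mul_comm, pow_mul]; norm_num
    have a3 : N (r1 + u) ^ 3 * 9 ^ u ≤ 18 * y ^ 3 := by
      have h9 : (0 : ℝ) < 9 ^ (r1 + u) := by positivity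
      refine le_of_mul_le_mul_right ?_ h9
      calc N (r1 + u) ^ 3 * 9 ^ u * 9 ^ (r1 + u)
          = (N (r1 + u) ^ 3 * 9 ^ (r1 + u)) * 9 ^ u := by ring
        _ ≤ 18 * y ^ 5 * 9 ^ u := by gcongr
        _ = 18 * y ^ 3 * (y ^ 2 * 9 ^ u) := by ring
        _ ≤ 18 * y ^ 3 * 9 ^ (r1 + u) := by gcongr
    have a4 : (N (r1 + u) * 2 ^ u) ^ 3 ≤ (2.621 * y) ^ 3 := by
      calc (N (r1 + u) * 2 ^ u) ^ 3 = N (r1 + u) ^ 3 * 8 ^ u := by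
            rw [mul_pow, ← pow_mul, mul_comm u 3, pow_mul]; norm_num
        _ ≤ N (r1 + u) ^ 3 * 9 ^ u := by gcongr; norm_num
        _ ≤ 18 * y ^ 3 := a3
        _ ≤ (2.621 * y) ^ 3 := by
            rw [mul_pow]; gcongr; norm_num
    have a5 : N (r1 + u) * 2 ^ u ≤ 2.621 * y :=
      le_of_pow_le_pow_left₀ (by norm_num) (by positivity) a4
    rw [one_div, inv_pow, ← div_eq_mul_inv, le_div_iff₀ (by positivity)]
    exact a5
  calc ∑ r ∈ range R, N r ≤ ∑ r ∈ range (r1 + R), N r :=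
        sum_le_sum_of_subset_of_nonneg (range_subset_range.2 (by omega)) (fun r _ _ => hN r)
    _ = ∑ r ∈ range r1, N r + ∑ u ∈ range R, N (r1 + u) := sum_range_add _ _ _
    _ ≤ 3 * y + ∑ u ∈ range R, 2.621 * y * (1 / 2) ^ u := by
        gcongr with u _; exact htail u
    _ ≤ 8.242 * y := by
        rw [← mul_sum, hgeo2]
        have : (0 : ℝ) ≤ (1 / 2) ^ R := by positivity
        nlinarith [mul_nonneg hy this]

/-- Extension of `f` to all of `ℕ`, shifted by one. -/
def extF (f : ℕ → ℝ) (m : ℕ) (x : ℕ) : ℝ := f (min (x + 1) (3 ^ m))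

/-- Block sums of a function on `ℕ`. -/
noncomputable def blk (g : ℕ → ℝ) (h u : ℕ) : ℝ := ∑ x ∈ range h, g (u * h + x)

lemma blk_eq (f : ℕ → ℝ) (m j u : ℕ) (hj : j ≤ m) (hu : u < 3 ^ j) :
    blockSum3 f m j u = blk (extF f m) (3 ^ (m - j)) u := by
  unfold blockSum3 nodeInterval3 blk extF
  have h1 : (u + 1) * 3 ^ (m - j) ≤ 3 ^ m := by
    calc (u + 1) * 3 ^ (m - j) ≤ 3 ^ j * 3 ^ (m - j) := Nat.mul_le_mul_right _ hu
      _ = 3 ^ m := by rw [← pow_add]; congr 1; omega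
  generalize 3 ^ (m - j) = h at *
  have h2 : Finset.Icc (u * h + 1) ((u + 1) * h) = Finset.Ico (u * h + 1) (u * h + 1 + h) := by
    ext x; simp only [mem_Icc, mem_Ico]; rw [add_mul, one_mul]; omega
  rw [h2, Finset.sum_Ico_eq_sum_range]
  simp only [Nat.add_sub_cancel_left]
  apply sum_congr rfl
  intro x hx
  have := mem_range.1 hx
  rw [add_mul, one_mul] at h1
  congr 1
  rw [min_eq_left (by omega)]
  omega

lemma blk_tel (g : ℕ → ℝ) (h u : ℕ) :
    blk g h u = ∑ x ∈ range ((u + 1) * h), g x - ∑ x ∈ range (u * h), g x := by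
  rw [add_mul, one_mul, sum_range_add]; unfold blk; ring

lemma blk_anti (g : ℕ → ℝ) (hg : Antitone g) (h u : ℕ) : 0 ≤ blk g h u - blk g h (u + 1) := by
  unfold blk
  rw [← sum_sub_distrib]
  apply sum_nonneg
  intro x _
  apply sub_nonneg.2
  apply hg
  rw [add_mul]; omega

lemma blk_conv (g : ℕ → ℝ) (hg : Antitone (fun x => g x - g (x + 1))) (h u : ℕ) :
    blk g h (u + 1) - blk g h (u + 2) ≤ blk g h u - blk g h (u + 1) := by
  unfold blk
  rw [← sum_sub_distrib, ← sum_sub_distrib]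
  apply sum_le_sum
  intro x _
  have tel : ∀ a, g a - g (a + h) = ∑ z ∈ range h, (g (a + z) - g (a + z + 1)) := by
    intro a
    have := Finset.sum_range_sub' (fun z => g (a + z)) h
    simpa [add_assoc] using this.symm
  have e1 : (u + 1) * h + x = (u * h + x) + h := by ring
  have e2 : (u + 2) * h + x = (u * h + x) + h + h := by ring
  rw [e1, e2, tel, tel]
  apply sum_le_sum
  intro z _
  exact hg (show u * h + x + z ≤ u * h + x + h + z by omega)

lemma ring_level (f : ℕ → ℝ) (n m : ℕ) (hn : 0 < n) (hf0 : ∀ x, 0 ≤ f x)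
    (hanti : Antitone (extF f m))
    (hconv : Antitone (fun x => extF f m x - extF f m (x + 1)))
    (q r : ℕ) (hq : 1 ≤ q) (T : Finset ℕ)
    (hT : ∀ i ∈ T, 3 ^ r ≤ i ∧ i < 3 ^ (r + 1) ∧ Splits3 f n m (q + r) i) :
    (T.card : ℝ) ^ 3 * 9 ^ r ≤ 18 * (n * (∑ x ∈ range (3 ^ (m - q)), extF f m x -
      ∑ x ∈ range (3 ^ (m - q - 1)), extF f m x)) := by
  have hn' : (0 : ℝ) < n := by exact_mod_cast hn
  set g := extF f m with hg
  have hg0 : ∀ x, 0 ≤ g x := fun x => hf0 _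
  set F : ℕ → ℝ := fun t => ∑ x ∈ range t, g x with hF
  have hFmono : Monotone F := fun a b hab =>
    sum_le_sum_of_subset_of_nonneg (range_subset_range.2 hab) (fun x _ _ => hg0 x)
  rcases T.eq_empty_or_nonempty with h | ⟨i0, hi0⟩
  · subst h
    simp only [card_empty, Nat.cast_zero]
    have : F (3 ^ (m - q - 1)) ≤ F (3 ^ (m - q)) := hFmono (Nat.pow_le_pow_right (by norm_num) (by omega))
    have h2 := mul_nonneg hn'.le (sub_nonneg.2 this)
    simp only [hF] at h2
    norm_num; exact (mul_nonneg_iff_of_pos_left hn').1 h2 |> sub_nonneg.1 |> fun h => by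
      first | exact h | (apply mul_nonneg hn'.le; linarith)
  have hj : q + r < m := (hT i0 hi0).2.2.1
  set h := 3 ^ (m - (q + r + 1)) with hh
  have hrec := recursion_aux (blk g h) n hn' (fun u => sum_nonneg (fun x _ => hg0 _))
    (blk_anti g hanti h) (blk_conv g hconv h) T (by
      intro i hi
      obtain ⟨a1, a2, a3, a4⟩ := hT i hi
      have hlt : 3 * i + 2 < 3 ^ (q + r + 1) := by
        have h1 : i + 1 ≤ 3 ^ (q + r) := a2.trans_le (Nat.pow_le_pow_right (by norm_num) (by omega))
        rw [pow_succ]; omega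
      rw [blk_eq f m _ _ (by omega) (by omega), blk_eq f m _ _ (by omega) (by omega),
        blk_eq f m _ _ (by omega) (by omega)] at a4
      exact a4) (3 ^ (r + 1)) (fun i hi => by have := (hT i hi).1; rw [pow_succ]; omega)
  have hd := hrec.2
  set N : ℝ := (T.card : ℝ)
  have hN : 0 ≤ N := Nat.cast_nonneg _
  set d := blk g h (3 ^ (r + 1)) - blk g h (3 ^ (r + 1) + 1) with hdd
  have hN3 : N ^ 3 / 18 ≤ n * d := by
    refine le_trans ?_ hd
    nlinarith [sq_nonneg N]
  have hdanti : Antitone (fun u => blk g h u - blk g h (u + 1)) :=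
    antitone_nat_of_succ_le (blk_conv g hconv h)
  have hblow : ∀ t : ℕ, t ≤ 3 ^ (r + 1) → (t : ℝ) * d ≤ blk g h (3 ^ (r + 1) - t) := by
    intro t
    induction t with
    | zero => intro _; simp; exact sum_nonneg (fun x _ => hg0 _)
    | succ t ih =>
      intro ht
      have a1 := ih (by omega)
      have a2 := hdanti (show 3 ^ (r + 1) - (t + 1) ≤ 3 ^ (r + 1) by omega)
      simp only at a2
      rw [show 3 ^ (r + 1) - (t + 1) + 1 = 3 ^ (r + 1) - t by omega] at a2
      push_cast
      linarith
  have hbanti : Antitone (blk g h) :=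
    antitone_nat_of_succ_le (fun u => by linarith [blk_anti g hanti h u])
  have hmass : ∀ t : ℕ, t ≤ 3 ^ r → (t : ℝ) * (3 ^ r * d) ≤ F ((3 ^ r + t) * h) - F (3 ^ r * h) := by
    intro t
    induction t with
    | zero => intro _; simp
    | succ t ih =>
      intro ht
      have a1 := ih (by omega)
      have a2 := blk_tel g h (3 ^ r + t)
      have hp : 3 ^ (r + 1) = 3 * 3 ^ r := by rw [pow_succ]; ring
      have a3 := hblow (3 ^ r) (by omega)
      have a4 := hbanti (show 3 ^ r + t ≤ 3 ^ (r + 1) - 3 ^ r by omega)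
      push_cast at a3 ⊢
      simp only [hF] at a1 ⊢
      rw [← add_assoc]
      linarith
  have hm1 := hmass (3 ^ r) le_rfl
  have e1 : 3 ^ r * h = 3 ^ (m - q - 1) := by
    rw [hh, ← pow_add]; congr 1; omega
  have e2 : (3 ^ r + 3 ^ r) * h ≤ 3 ^ (m - q) := by
    rw [show m - q = (m - q - 1) + 1 by omega, pow_succ, ← e1]
    nlinarith [Nat.zero_le (3 ^ r * h)]
  have hm2 := hFmono e2
  rw [e1] at hm1
  push_cast at hm1
  have h9 : (3 : ℝ) ^ r * 3 ^ r = 9 ^ r := by rw [← mul_pow]; norm_num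
  have hm3 : 9 ^ r * d ≤ F (3 ^ (m - q)) - F (3 ^ (m - q - 1)) := by
    rw [← h9, mul_assoc]; linarith
  have hm4 := mul_le_mul_of_nonneg_left hm3 hn'.le
  have hm5 := mul_le_mul_of_nonneg_right hN3 (show (0 : ℝ) ≤ 9 ^ r by positivity)
  simp only [hF] at hm4
  nlinarith

lemma extF_anti (f : ℕ → ℝ) (m : ℕ)
    (hmono : ∀ x, 1 ≤ x → x + 1 ≤ 3 ^ m → f (x + 1) ≤ f x) : Antitone (extF f m) := by
  apply antitone_nat_of_succ_le
  intro x
  unfold extF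
  rcases lt_or_ge (x + 1) (3 ^ m) with h | h
  · rw [min_eq_left (by omega), min_eq_left (by omega)]
    exact hmono _ (by omega) (by omega)
  · rw [min_eq_right (by omega), min_eq_right (by omega)]

lemma extF_conv (f : ℕ → ℝ) (m : ℕ)
    (hmono : ∀ x, 1 ≤ x → x + 1 ≤ 3 ^ m → f (x + 1) ≤ f x)
    (hconv : ∀ x, 1 ≤ x → x + 2 ≤ 3 ^ m → 0 ≤ f x - 2 * f (x + 1) + f (x + 2)) :
    Antitone (fun x => extF f m x - extF f m (x + 1)) := by
  apply antitone_nat_of_succ_le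
  intro x
  have ha := extF_anti f m hmono (Nat.le_succ x)
  unfold extF at *
  rcases lt_or_ge (x + 2) (3 ^ m) with h | h
  · rw [min_eq_left (by omega), min_eq_left (by omega), min_eq_left (by omega)]
    have := hconv (x + 1) (by omega) (by omega)
    simp only [add_assoc, Nat.reduceAdd] at this ⊢
    linarith
  · rw [min_eq_right (show 3 ^ m ≤ x + 1 + 1 by omega),
      min_eq_right (show 3 ^ m ≤ x + 1 + 1 + 1 by omega)]
    rw [min_eq_right (show 3 ^ m ≤ x.succ + 1 by omega)] at ha
    linarith

lemma extF_sum (f : ℕ → ℝ) (m : ℕ) :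
    ∑ x ∈ range (3 ^ m), extF f m x = ∑ x ∈ Finset.Icc 1 (3 ^ m), f x := by
  have := blk_eq f m 0 0 (by omega) (by simp)
  unfold blockSum3 nodeInterval3 blk at this
  simpa using this.symm

lemma inTree_lt (f : ℕ → ℝ) (n m j i : ℕ) (h : InTree3 f n m j i) : i < 3 ^ j := by
  induction j generalizing i with
  | zero => simp only [InTree3] at h; simp [h]
  | succ j ih =>
    have := ih _ h.1
    rw [pow_succ]; omega

open Classical in
/-- Splitting nodes at depth `q + r` inside ring `q`. -/
noncomputable def ringSet (f : ℕ → ℝ) (n m q r : ℕ) : Finset ℕ :=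
  (Finset.Ico (3 ^ r) (3 ^ (r + 1))).filter (fun i => Splits3 f n m (q + r) i)

lemma count_leaves (f : ℕ → ℝ) (n m s : ℕ) (hs : s ≤ m) (L : Finset (ℕ × ℕ))
    (hL : ∀ p : ℕ × ℕ, p ∈ L ↔ IsLeaf3 f n m p.1 p.2) :
    L.card ≤ 1 + 3 * (∑ u ∈ range s, 3 ^ u + (m - s) +
      ∑ q ∈ range (m - s), ∑ r ∈ range m, (ringSet f n m (q + 1) r).card) := by
  classical
  set Q := m - s with hQ
  let A : Finset (ℕ × ℕ) :=
    (range s).biUnion (fun u => (range (3 ^ u)).image (fun i => (Q + u, i)))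
  let B : Finset (ℕ × ℕ) := (range Q).image (fun j => (j, 0))
  let C : Finset (ℕ × ℕ) := (range Q).biUnion (fun q => (range m).biUnion (fun r =>
    (ringSet f n m (q + 1) r).image (fun i => (q + 1 + r, i))))
  let T := (A ∪ B) ∪ C
  have hTmem : ∀ j i, i < 3 ^ j → Splits3 f n m j i → (j, i) ∈ T := by
    intro j i hi hsp
    have hjm : j < m := hsp.1
    by_cases hA : Q ≤ j ∧ i < 3 ^ (j - Q)
    · refine mem_union_left _ (mem_union_left _ ?_)
      refine mem_biUnion.2 ⟨j - Q, mem_range.2 (by omega), mem_image.2 ⟨i, mem_range.2 hA.2, ?_⟩⟩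
      rw [Nat.add_sub_cancel' hA.1]
    · by_cases h0 : i = 0
      · subst h0
        refine mem_union_left _ (mem_union_right _ ?_)
        refine mem_image.2 ⟨j, mem_range.2 ?_, rfl⟩
        by_contra hcon
        exact hA ⟨by omega, by positivity⟩
      · refine mem_union_right _ ?_
        have l1 : 3 ^ (Nat.log 3 i) ≤ i := Nat.pow_log_le_self 3 h0
        have l2 : i < 3 ^ (Nat.log 3 i + 1) := Nat.lt_pow_succ_log_self (by norm_num) i
        set r := Nat.log 3 i
        have hrj : r < j := (Nat.pow_lt_pow_iff_right (by norm_num : 1 < 3)).1 (l1.trans_lt hi)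
        have hq : j - r ≤ Q := by
          by_contra hcon
          push Not at hcon
          exact hA ⟨by omega, l2.trans_le (Nat.pow_le_pow_right (by norm_num) (by omega))⟩
        have hjr : j - r - 1 + 1 + r = j := by omega
        refine mem_biUnion.2 ⟨j - r - 1, mem_range.2 (by omega), mem_biUnion.2
          ⟨r, mem_range.2 (by omega), mem_image.2 ⟨i, ?_, by rw [hjr]⟩⟩⟩
        unfold ringSet
        rw [mem_filter, mem_Ico, hjr]
        exact ⟨⟨l1, l2⟩, hsp⟩
  have hLsub : L ⊆ {(0, 0)} ∪ (T ×ˢ range 3).image (fun p => (p.1.1 + 1, 3 * p.1.2 + p.2)) := by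
    rintro ⟨j, i⟩ hp
    have hleaf := (hL _).1 hp
    cases j with
    | zero =>
      have : i = 0 := hleaf.1
      subst this
      simp
    | succ j =>
      have h1 : InTree3 f n m j (i / 3) ∧ Splits3 f n m j (i / 3) := hleaf.1
      refine mem_union_right _ (mem_image.2 ⟨((j, i / 3), i % 3), mem_product.2
        ⟨hTmem _ _ (inTree_lt _ _ _ _ _ h1.1) h1.2, mem_range.2 (Nat.mod_lt _ (by norm_num))⟩, ?_⟩)
      simp only [Prod.mk.injEq, true_and]
      omega
  have cA : A.card ≤ ∑ u ∈ range s, 3 ^ u :=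
    card_biUnion_le.trans (sum_le_sum (fun u _ => card_image_le.trans (by simp)))
  have cB : B.card ≤ Q := card_image_le.trans (by simp)
  have cC : C.card ≤ ∑ q ∈ range Q, ∑ r ∈ range m, (ringSet f n m (q + 1) r).card :=
    card_biUnion_le.trans (sum_le_sum (fun q _ => card_biUnion_le.trans
      (sum_le_sum (fun r _ => card_image_le))))
  have cT : T.card ≤ (A.card + B.card) + C.card :=
    (card_union_le _ _).trans (Nat.add_le_add_right (card_union_le _ _) _)
  have cL := (card_le_card hLsub).trans (card_union_le _ _)
  have cI : ((T ×ˢ range 3).image (fun p => (p.1.1 + 1, 3 * p.1.2 + p.2))).card ≤ T.card * 3 :=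
    card_image_le.trans (by rw [card_product]; simp)
  simp only [card_singleton] at cL
  omega

lemma inner_pow_le (s : Finset ℕ) (Y : ℕ → ℝ) (hY : ∀ q ∈ s, 0 ≤ Y q) :
    (∑ q ∈ s, Y q) ^ 5 ≤ (s.card : ℝ) ^ 4 * ∑ q ∈ s, Y q ^ 5 := by
  exact pow_sum_le_card_mul_sum_pow (s := s) (f := Y) hY 4

/-- **Proposition 4.2**: for `k = 3^m` a power of three and `f` a non-increasing
convex probability density on `{1, …, k}`, if `n ≥ 3^{10}` and
`3 n^{1/5} ≤ k < n^{1/5} 3^n`, then the leaf set `L†` of the idealized ternary tree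
`T†(f)` satisfies `|L†| ≤ 34 n^{1/5} (log₃(k / n^{1/5}))^{4/5}`. -/
theorem stmt15 (m n : ℕ) (hn : 3 ^ 10 ≤ n) (f : ℕ → ℝ)
    (hf0 : ∀ x, 0 ≤ f x)
    (hf1 : ∑ x ∈ Finset.Icc 1 (3 ^ m), f x = 1)
    (hmono : ∀ x, 1 ≤ x → x + 1 ≤ 3 ^ m → f (x + 1) ≤ f x)
    (hconv : ∀ x, 1 ≤ x → x + 2 ≤ 3 ^ m → 0 ≤ f x - 2 * f (x + 1) + f (x + 2))
    (hk1 : 3 * (n : ℝ) ^ ((1 : ℝ) / 5) ≤ (3 : ℝ) ^ m)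
    (hk2 : (3 : ℝ) ^ m < (n : ℝ) ^ ((1 : ℝ) / 5) * 3 ^ n)
    (L : Finset (ℕ × ℕ))
    (hL : ∀ p : ℕ × ℕ, p ∈ L ↔ IsLeaf3 f n m p.1 p.2) :
    (L.card : ℝ) ≤
      34 * (n : ℝ) ^ ((1 : ℝ) / 5) *
        (Real.logb 3 ((3 : ℝ) ^ m / (n : ℝ) ^ ((1 : ℝ) / 5))) ^ ((4 : ℝ) / 5) := by
  have hn0 : 0 < n := lt_of_lt_of_le (by norm_num) hn
  have hnR : (0 : ℝ) < n := by exact_mod_cast hn0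
  set y : ℝ := (n : ℝ) ^ ((1 : ℝ) / 5) with hy
  have hy0 : 0 < y := Real.rpow_pos_of_pos hnR _
  have hy5 : y ^ 5 = n := by
    rw [hy, ← Real.rpow_natCast, ← Real.rpow_mul hnR.le]; norm_num
  have hy9 : 9 ≤ y := by
    refine le_of_pow_le_pow_left₀ (n := 5) (by norm_num) hy0.le ?_
    rw [hy5]
    have : ((3 ^ 10 : ℕ) : ℝ) ≤ n := by exact_mod_cast hn
    norm_num at this ⊢
    exact this
  -- choose `s`
  obtain ⟨s, hs1, hs2⟩ : ∃ s : ℕ, y ≤ 3 ^ s ∧ (3 : ℝ) ^ s ≤ 3 * y := by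
    classical
    have hex : ∃ r : ℕ, y ≤ 3 ^ r := by
      obtain ⟨r, hr⟩ := pow_unbounded_of_one_lt y (by norm_num : (1 : ℝ) < 3)
      exact ⟨r, hr.le⟩
    refine ⟨Nat.find hex, Nat.find_spec hex, ?_⟩
    rcases Nat.eq_zero_or_pos (Nat.find hex) with h | h
    · rw [h]; norm_num; linarith
    · have := Nat.find_min hex (show Nat.find hex - 1 < Nat.find hex by omega)
      push Not at this
      rw [show Nat.find hex = (Nat.find hex - 1) + 1 by omega, pow_succ]
      linarith
  have hsm : s ≤ m := by
    have : (3 : ℝ) ^ s ≤ 3 ^ m := hs2.trans hk1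
    exact (pow_le_pow_iff_right₀ (by norm_num : (1 : ℝ) < 3)).1 this
  have hspos : 1 ≤ s := by
    by_contra h
    have : s = 0 := by omega
    rw [this] at hs1
    norm_num at hs1; linarith
  set M : ℝ := Real.logb 3 ((3 : ℝ) ^ m / y) with hM
  have hM1 : 1 ≤ M := by
    rw [hM, Real.le_logb_iff_rpow_le (by norm_num) (by positivity), Real.rpow_one,
      le_div_iff₀ hy0]
    exact hk1
  have hMn : M ≤ n := by
    rw [hM, Real.logb_le_iff_le_rpow (by norm_num) (by positivity), Real.rpow_natCast,
      div_le_iff₀ hy0]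
    linarith
  have hQM : ((m - s : ℕ) : ℝ) ≤ M := by
    rw [hM, Real.le_logb_iff_rpow_le (by norm_num) (by positivity), Real.rpow_natCast,
      le_div_iff₀ hy0]
    calc (3 : ℝ) ^ (m - s) * y ≤ 3 ^ (m - s) * 3 ^ s := by gcongr
      _ = 3 ^ m := by rw [← pow_add]; congr 1; omega
  have hanti := extF_anti f m hmono
  have hcv := extF_conv f m hmono hconv
  set F : ℕ → ℝ := fun t => ∑ x ∈ range t, extF f m x with hF
  have hFmono : Monotone F := fun a b hab =>
    sum_le_sum_of_subset_of_nonneg (range_subset_range.2 hab) (fun x _ _ => hf0 _)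
  have hF0 : ∀ t, 0 ≤ F t := fun t => sum_nonneg (fun x _ => hf0 _)
  have hF1 : F (3 ^ m) = 1 := by rw [hF]; simp only; rw [extF_sum, hf1]
  let P : ℕ → ℝ := fun q => n * (F (3 ^ (m - (q + 1))) - F (3 ^ (m - (q + 1) - 1)))
  have hP0 : ∀ q, 0 ≤ P q := fun q => mul_nonneg hnR.le (sub_nonneg.2
    (hFmono (Nat.pow_le_pow_right (by norm_num) (by omega))))
  let Y : ℕ → ℝ := fun q => (P q) ^ ((1 : ℝ) / 5)
  have hY0 : ∀ q, 0 ≤ Y q := fun q => Real.rpow_nonneg (hP0 q) _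
  have hY5 : ∀ q, Y q ^ 5 = P q := by
    intro q
    change ((P q) ^ ((1 : ℝ) / 5)) ^ 5 = P q
    rw [← Real.rpow_natCast, ← Real.rpow_mul (hP0 q)]; norm_num
  classical
  have hring : ∀ q, ∑ r ∈ range m, ((ringSet f n m (q + 1) r).card : ℝ) ≤ 8.242 * Y q := by
    intro q
    apply sum_levels _ _ (hY0 q)
    · intro r
      have h1 : (ringSet f n m (q + 1) r).card ≤ 2 * 3 ^ r := by
        refine (card_filter_le _ _).trans ?_
        rw [Nat.card_Ico, pow_succ]; omega
      exact_mod_cast h1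
    · intro r
      rw [hY5]
      refine ring_level f n m hn0 hf0 hanti hcv (q + 1) r (by omega) _ ?_
      intro i hi
      unfold ringSet at hi
      rw [mem_filter, mem_Ico] at hi
      exact ⟨hi.1.1, hi.1.2, hi.2⟩
    · intro r; exact Nat.cast_nonneg _
  have hPsum : ∑ q ∈ range (m - s), P q ≤ n := by
    have tel : ∀ t, ∑ q ∈ range t, P q = n * (F (3 ^ (m - 1)) - F (3 ^ (m - (t + 1)))) := by
      intro t
      induction t with
      | zero => simp
      | succ t ih =>
        rw [sum_range_succ, ih]
        simp only [P]
        rw [show m - (t + 1) - 1 = m - (t + 1 + 1) by omega]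
        ring
    rw [tel]
    have h1 : F (3 ^ (m - 1)) ≤ 1 := by
      rw [← hF1]; exact hFmono (Nat.pow_le_pow_right (by norm_num) (by omega))
    have h2 := hF0 (3 ^ (m - (m - s + 1)))
    nlinarith
  set Z : ℝ := M ^ ((4 : ℝ) / 5) with hZ
  have hM0 : 0 ≤ M := by linarith
  have hZ0 : 0 ≤ Z := Real.rpow_nonneg hM0 _
  have hZ5 : Z ^ 5 = M ^ 4 := by
    rw [hZ, ← Real.rpow_natCast, ← Real.rpow_mul hM0, ← Real.rpow_natCast]; norm_num
  have hZ1 : 1 ≤ Z := Real.one_le_rpow hM1 (by norm_num)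
  have hYsum : ∑ q ∈ range (m - s), Y q ≤ y * Z := by
    refine le_of_pow_le_pow_left₀ (n := 5) (by norm_num) (by positivity) ?_
    rw [mul_pow, hy5, hZ5]
    have h1 := inner_pow_le (range (m - s)) Y (fun q _ => hY0 q)
    rw [card_range, sum_congr rfl (fun q _ => hY5 q)] at h1
    calc _ ≤ ((m - s : ℕ) : ℝ) ^ 4 * ∑ q ∈ range (m - s), P q := h1
      _ ≤ M ^ 4 * n := by gcongr; exact sum_nonneg (fun q _ => hP0 q)
      _ = n * M ^ 4 := mul_comm _ _
  have hMyZ : M ≤ y * Z := by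
    refine le_of_pow_le_pow_left₀ (n := 5) (by norm_num) (by positivity) ?_
    rw [mul_pow, hy5, hZ5, pow_succ, mul_comm]
    gcongr
  have hcount := count_leaves f n m s hsm L hL
  have hcR : (L.card : ℝ) ≤ 1 + 3 * (∑ u ∈ range s, (3 : ℝ) ^ u + ((m - s : ℕ) : ℝ) +
      ∑ q ∈ range (m - s), ∑ r ∈ range m, ((ringSet f n m (q + 1) r).card : ℝ)) := by
    exact_mod_cast hcount
  have hgeo : ∀ t : ℕ, ∑ u ∈ range t, (3 : ℝ) ^ u = (3 ^ t - 1) / 2 := by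
    intro t
    induction t with
    | zero => simp
    | succ t ih => rw [sum_range_succ, ih]; ring
  rw [hgeo] at hcR
  have hR : ∑ q ∈ range (m - s), ∑ r ∈ range m, ((ringSet f n m (q + 1) r).card : ℝ) ≤
      8.242 * (y * Z) := by
    refine (sum_le_sum (fun q _ => hring q)).trans ?_
    rw [← mul_sum]
    gcongr
  have hyZ : y ≤ y * Z := by nlinarith
  rw [mul_assoc]
  linarith
end
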